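/- arXiv:1002.4711 — 2 statements merged into one kernel-verified Lean document; each statement's English description precedes it below -/
import Mathlib

section
/- Let A be a C*-algebra and X, Y ∈ 𝒫. Then: (a) X ∧ Ann(X) = {0} and X ∨ Ann(X) = A in the lattice 𝒫; (b) Ann(Ann(X)) = X, and if X ≠ A then Ann(X) ≠ {0}; (c) Ann(X ∨ Y) = Ann(X) ∧ Ann(Y) and Ann(X ∧ Y) = Ann(X) ∨ Ann(Y). -/
/-- The annihilator of a set `S`: elements anticommuting with every member of `S`. -/
def Ann {A : Type*} [NonUnitalNonAssocRing A] (S : Set A) : Set A :=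
  {a : A | ∀ s ∈ S, a * s + s * a = 0}

/-- The set `𝒫` of annihilators: sets of the form `Ann (Ann S)` with `S ⊆ A₊`. -/
def PAnn (A : Type*) [NonUnitalNonAssocRing A] [PartialOrder A] : Set (Set A) :=
  {V | ∃ S : Set A, (∀ s ∈ S, 0 ≤ s) ∧ V = Ann (Ann S)}

/-- `V` is the least upper bound of the family `T` within the collection `P` (ordered by `⊆`). -/
def IsLUBIn {α : Type*} (P T : Set (Set α)) (V : Set α) : Prop :=
  V ∈ P ∧ (∀ W ∈ T, W ⊆ V) ∧ ∀ U ∈ P, (∀ W ∈ T, W ⊆ U) → V ⊆ U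

/-- `V` is the greatest lower bound of the family `T` within the collection `P`. -/
def IsGLBIn {α : Type*} (P T : Set (Set α)) (V : Set α) : Prop :=
  V ∈ P ∧ (∀ W ∈ T, V ⊆ W) ∧ ∀ U ∈ P, (∀ W ∈ T, U ⊆ W) → U ⊆ V

section Ann

variable {A : Type*}

section Ring

variable [NonUnitalNonAssocRing A] {S T : Set A}

lemma subset_Ann_comm : S ⊆ Ann T ↔ T ⊆ Ann S :=
  ⟨fun h t ht s hs => by rw [add_comm]; exact h hs t ht,
    fun h s hs t ht => by rw [add_comm]; exact h ht s hs⟩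

lemma subset_Ann_Ann (S : Set A) : S ⊆ Ann (Ann S) := subset_Ann_comm.1 subset_rfl

lemma Ann_anti (h : S ⊆ T) : Ann T ⊆ Ann S := subset_Ann_comm.1 (h.trans (subset_Ann_Ann T))

lemma Ann_Ann_Ann (S : Set A) : Ann (Ann (Ann S)) = Ann S :=
  (Ann_anti (subset_Ann_Ann S)).antisymm (subset_Ann_Ann _)

lemma Ann_zero : Ann ({0} : Set A) = Set.univ := by
  ext a
  simp [Ann]

lemma zero_subset_Ann (S : Set A) : {0} ⊆ Ann S := by
  rw [subset_Ann_comm, Ann_zero]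
  exact Set.subset_univ S

lemma Ann_Ann_of_mem_PAnn [PartialOrder A] {X : Set A} (hX : X ∈ PAnn A) : Ann (Ann X) = X := by
  obtain ⟨S, -, rfl⟩ := hX
  exact Ann_Ann_Ann _

lemma eq_univ_of_Ann_subset_zero [PartialOrder A] {X : Set A} (hX : X ∈ PAnn A)
    (h : Ann X ⊆ {0}) : X = Set.univ := by
  rw [← Ann_Ann_of_mem_PAnn hX, h.antisymm (zero_subset_Ann X), Ann_zero]

end Ring

variable [NonUnitalCStarAlgebra A] [PartialOrder A] [StarOrderedRing A] {S X : Set A}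

/-- An element anticommuting with a positive element `s` annihilates `s` on both sides. -/
lemma mul_eq_zero_of_anticommute_nonneg {a s : A} (hs : 0 ≤ s) (h : a * s + s * a = 0) :
    a * s = 0 ∧ s * a = 0 := by
  have h_neg : a * s = -(s * a) := eq_neg_of_add_eq_zero_left h
  have h_sq : Commute (s * s) a := by
    change s * s * a = a * (s * s)
    rw [← mul_assoc, h_neg, neg_mul, mul_assoc s a s, h_neg, mul_neg, neg_neg, mul_assoc]
  have h_comm : Commute s a := by
    have := h_sq.cfcₙ_nnreal NNReal.sqrt
    rwa [← CFC.sqrt, CFC.sqrt_mul_self s hs] at this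
  rw [← h_comm.eq, ← two_smul ℂ, smul_eq_zero_iff_right two_ne_zero] at h
  exact ⟨h_comm.eq ▸ h, h⟩

lemma mem_Ann_iff_of_nonneg (hS : ∀ s ∈ S, 0 ≤ s) {a : A} :
    a ∈ Ann S ↔ ∀ s ∈ S, a * s = 0 ∧ s * a = 0 :=
  ⟨fun h s hs => mul_eq_zero_of_anticommute_nonneg (hS s hs) (h s hs),
    fun h s hs => by rw [(h s hs).1, (h s hs).2, add_zero]⟩

lemma star_mem_Ann (hS : ∀ s ∈ S, 0 ≤ s) {a : A} (ha : a ∈ Ann S) : star a ∈ Ann S := by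
  intro s hs
  have := congrArg star (ha s hs)
  simpa [(IsSelfAdjoint.of_nonneg (hS s hs)).star_eq, add_comm] using this

lemma mul_mem_Ann (hS : ∀ s ∈ S, 0 ≤ s) {a b : A} (ha : a ∈ Ann S) (hb : b ∈ Ann S) :
    a * b ∈ Ann S := by
  rw [mem_Ann_iff_of_nonneg hS] at *
  intro s hs
  rw [mul_assoc, (hb s hs).1, ← mul_assoc, (ha s hs).2]
  simp

/-- The annihilator of `Ann S`, for `S` positive, is determined by the positive part of `Ann S`. -/
lemma Ann_Ann_inter_nonneg (hS : ∀ s ∈ S, 0 ≤ s) :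
    Ann (Ann S ∩ {a | 0 ≤ a}) = Ann (Ann S) := by
  refine Set.Subset.antisymm (fun b hb a ha => ?_) (Ann_anti Set.inter_subset_left)
  have ha' := star_mem_Ann hS ha
  rw [mem_Ann_iff_of_nonneg fun s hs => hs.2] at hb
  have h₁ := (hb (a * star a) ⟨mul_mem_Ann hS ha ha', mul_star_self_nonneg a⟩).1
  have h₂ := (hb (star a * a) ⟨mul_mem_Ann hS ha' ha, star_mul_self_nonneg a⟩).2
  have h₃ : b * a = 0 := by
    rw [← CStarRing.mul_star_self_eq_zero_iff, star_mul, mul_assoc, ← mul_assoc a, ← mul_assoc, h₁,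
      zero_mul]
  have h₄ : a * b = 0 := by
    rw [← CStarRing.star_mul_self_eq_zero_iff, star_mul, mul_assoc, ← mul_assoc (star a), h₂,
      mul_zero]
  rw [h₃, h₄, add_zero]

lemma Ann_mem_PAnn_of_nonneg (hS : ∀ s ∈ S, 0 ≤ s) : Ann S ∈ PAnn A :=
  ⟨Ann S ∩ {a | 0 ≤ a}, fun _ hs => hs.2, by rw [Ann_Ann_inter_nonneg hS, Ann_Ann_Ann]⟩

lemma Ann_mem_PAnn (hX : X ∈ PAnn A) : Ann X ∈ PAnn A := by
  obtain ⟨S, hS, rfl⟩ := hX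
  rw [Ann_Ann_Ann]
  exact Ann_mem_PAnn_of_nonneg hS

lemma star_mem_of_mem_PAnn (hX : X ∈ PAnn A) {a : A} (ha : a ∈ X) : star a ∈ X := by
  obtain ⟨S, hS, rfl⟩ := hX
  rw [← Ann_Ann_inter_nonneg hS] at *
  exact star_mem_Ann (fun _ hs => hs.2) ha

lemma inter_Ann_subset_zero (hX : X ∈ PAnn A) : X ∩ Ann X ⊆ {0} := by
  rintro a ⟨ha, ha'⟩
  have h := ha' _ (star_mem_of_mem_PAnn hX ha)
  rw [add_eq_zero_iff_of_nonneg (mul_star_self_nonneg a) (star_mul_self_nonneg a)] at h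
  exact (CStarRing.mul_star_self_eq_zero_iff a).1 h.1

lemma univ_mem_PAnn : (Set.univ : Set A) ∈ PAnn A := by
  rw [← Ann_zero]
  exact Ann_mem_PAnn_of_nonneg (by simp)

lemma Ann_univ : Ann (Set.univ : Set A) = {0} :=
  Set.Subset.antisymm (fun _ ha => inter_Ann_subset_zero univ_mem_PAnn ⟨trivial, ha⟩)
    (zero_subset_Ann _)

lemma zero_mem_PAnn : ({0} : Set A) ∈ PAnn A := Ann_univ (A := A) ▸ Ann_mem_PAnn univ_mem_PAnn

end Ann

/-- For `X, Y ∈ 𝒫`: (a) `X ∧ Ann X = {0}` and `X ∨ Ann X = A`;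
(b) `Ann (Ann X) = X`, and if `X ≠ A` then `Ann X ≠ {0}`;
(c) `Ann (X ∨ Y) = Ann X ∧ Ann Y` and `Ann (X ∧ Y) = Ann X ∨ Ann Y`. -/
theorem stmt_5 {A : Type*} [NonUnitalCStarAlgebra A] [PartialOrder A] [StarOrderedRing A]
    (X Y : Set A) (hX : X ∈ PAnn A) (hY : Y ∈ PAnn A) :
    IsGLBIn (PAnn A) {X, Ann X} {0} ∧ IsLUBIn (PAnn A) {X, Ann X} Set.univ ∧
    Ann (Ann X) = X ∧ (X ≠ Set.univ → Ann X ≠ {0}) ∧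
    (∀ Z, IsLUBIn (PAnn A) {X, Y} Z → IsGLBIn (PAnn A) {Ann X, Ann Y} (Ann Z)) ∧
    (∀ Z, IsGLBIn (PAnn A) {X, Y} Z → IsLUBIn (PAnn A) {Ann X, Ann Y} (Ann Z)) := by
  have hXX := Ann_Ann_of_mem_PAnn hX
  have hYY := Ann_Ann_of_mem_PAnn hY
  simp only [IsGLBIn, IsLUBIn, Set.forall_mem_insert, Set.mem_singleton_iff, forall_eq]
  refine ⟨⟨zero_mem_PAnn, ⟨?_, zero_subset_Ann X⟩, ?_⟩,
    ⟨univ_mem_PAnn, ⟨Set.subset_univ _, Set.subset_univ _⟩, ?_⟩, hXX, ?_, ?_, ?_⟩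
  · exact hXX ▸ zero_subset_Ann (Ann X)
  · exact fun U _ h => (Set.subset_inter h.1 h.2).trans (inter_Ann_subset_zero hX)
  · intro U hU h
    rw [eq_univ_of_Ann_subset_zero hU]
    exact (Set.subset_inter ((Ann_anti h.2).trans hXX.le) (Ann_anti h.1)).trans
      (inter_Ann_subset_zero hX)
  · exact fun hne h => hne (eq_univ_of_Ann_subset_zero hX h.le)
  · rintro Z ⟨hZ, ⟨hXZ, hYZ⟩, hmin⟩
    refine ⟨Ann_mem_PAnn hZ, ⟨Ann_anti hXZ, Ann_anti hYZ⟩, fun U hU h => ?_⟩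
    exact subset_Ann_comm.1
      (hmin _ (Ann_mem_PAnn hU) ⟨subset_Ann_comm.1 h.1, subset_Ann_comm.1 h.2⟩)
  · rintro Z ⟨hZ, ⟨hZX, hZY⟩, hmax⟩
    refine ⟨Ann_mem_PAnn hZ, ⟨Ann_anti hZX, Ann_anti hZY⟩, fun U hU h => ?_⟩
    rw [← Ann_Ann_of_mem_PAnn hU]
    exact Ann_anti
      (hmax _ (Ann_mem_PAnn hU) ⟨(Ann_anti h.1).trans hXX.le, (Ann_anti h.2).trans hYY.le⟩)
end

section
/- Let A be a C*-algebra and let V be an Abelian annihilator of A. Then (a) the lattice 𝒫_V of relative annihilators of V is a Boolean algebra, and (b) 𝒫_V is a modular lattice (i.e. every Abelian annihilator is modular). -/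
/-- The relative annihilator of `S` in `B`: `{a ∈ B | a s + s a = 0 for all s ∈ S}`. -/
def AnnIn {A : Type*} [NonUnitalNonAssocRing A] (B S : Set A) : Set A :=
  {a ∈ B | ∀ s ∈ S, a * s + s * a = 0}

/-- The set `𝒫_B` of relative annihilators in `B`. -/
def PAnnIn {A : Type*} [NonUnitalNonAssocRing A] [PartialOrder A] (B : Set A) : Set (Set A) :=
  {V | ∃ S : Set A, S ⊆ B ∧ (∀ s ∈ S, 0 ≤ s) ∧ V = AnnIn B (AnnIn B S)}

section Annihilators

variable {A : Type*} [NonUnitalCStarAlgebra A]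

lemma add_self_eq_zero_iff {x : A} : x + x = 0 ↔ x = 0 := by
  rw [← two_smul ℂ, smul_eq_zero_iff_right two_ne_zero]

lemma mul_eq_zero_of_mul_mul_star_eq_zero {x b : A} (h : x * (b * star b) = 0) : x * b = 0 := by
  rw [← CStarRing.mul_star_self_eq_zero_iff, star_mul, ← mul_assoc, mul_assoc x, h, zero_mul]

lemma mul_eq_zero_of_star_mul_mul_eq_zero {x b : A} (h : star b * b * x = 0) : b * x = 0 := by
  rw [← CStarRing.star_mul_self_eq_zero_iff, star_mul, mul_assoc, ← mul_assoc (star b), h,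
    mul_zero]

/-- Anticommuting with a positive element amounts to annihilating it on both sides. -/
lemma mul_add_mul_eq_zero_iff_of_nonneg [PartialOrder A] [StarOrderedRing A] {a s : A}
    (hs : 0 ≤ s) : a * s + s * a = 0 ↔ a * s = 0 ∧ s * a = 0 := by
  refine ⟨fun h => ?_, fun h => by rw [h.1, h.2, add_zero]⟩
  have has : a * s = -(s * a) := eq_neg_of_add_eq_zero_left h
  have hsq : Commute (s * s) a := by
    rw [commute_iff_eq, ← mul_assoc a, has, neg_mul, mul_assoc s a, has, mul_neg, neg_neg,
      mul_assoc]
  have hc : Commute s a := by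
    rw [← CFC.sqrt_mul_self s hs, CFC.sqrt]
    exact hsq.cfcₙ_nnreal _
  rw [hc.eq, add_self_eq_zero_iff] at h
  exact ⟨h, hc.eq.trans h⟩

lemma mem_ann_iff_of_nonneg [PartialOrder A] [StarOrderedRing A] {S : Set A}
    (hS : ∀ s ∈ S, 0 ≤ s) {a : A} : a ∈ Ann S ↔ ∀ s ∈ S, a * s = 0 ∧ s * a = 0 :=
  forall₂_congr fun s hs => mul_add_mul_eq_zero_iff_of_nonneg (hS s hs)

lemma mem_ann_ann_iff_of_nonneg [PartialOrder A] [StarOrderedRing A] {S : Set A}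
    (hS : ∀ s ∈ S, 0 ≤ s) {a : A} :
    a ∈ Ann (Ann S) ↔ ∀ b ∈ Ann S, a * b = 0 ∧ b * a = 0 := by
  refine ⟨fun ha b hb => ?_, fun h b hb => by rw [(h b hb).1, (h b hb).2, add_zero]⟩
  have hb' := (mem_ann_iff_of_nonneg hS).mp hb
  have h₁ : b * star b ∈ Ann S := (mem_ann_iff_of_nonneg hS).mpr fun s hs => by
    have : star b * s = 0 := by
      rw [← (hS s hs).isSelfAdjoint.star_eq, ← star_mul, (hb' s hs).2, star_zero]
    exact ⟨by rw [mul_assoc, this, mul_zero], by rw [← mul_assoc, (hb' s hs).2, zero_mul]⟩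
  have h₂ : star b * b ∈ Ann S := (mem_ann_iff_of_nonneg hS).mpr fun s hs => by
    have : s * star b = 0 := by
      rw [← (hS s hs).isSelfAdjoint.star_eq, ← star_mul, (hb' s hs).1, star_zero]
    exact ⟨by rw [mul_assoc, (hb' s hs).1, mul_zero], by rw [← mul_assoc, this, zero_mul]⟩
  exact ⟨mul_eq_zero_of_mul_mul_star_eq_zero
      ((mul_add_mul_eq_zero_iff_of_nonneg (mul_star_self_nonneg b)).mp (ha _ h₁)).1,
    mul_eq_zero_of_star_mul_mul_eq_zero
      ((mul_add_mul_eq_zero_iff_of_nonneg (star_mul_self_nonneg b)).mp (ha _ h₂)).2⟩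

lemma mul_mem_of_mem_pAnn [PartialOrder A] [StarOrderedRing A] {V : Set A} (hV : V ∈ PAnn A)
    {x y : A} (hx : x ∈ V) (hy : y ∈ V) : x * y ∈ V := by
  obtain ⟨S, hS, rfl⟩ := hV
  rw [mem_ann_ann_iff_of_nonneg hS] at hx hy ⊢
  exact fun b hb => ⟨by rw [mul_assoc, (hy b hb).1, mul_zero],
    by rw [← mul_assoc, (hx b hb).2, zero_mul]⟩

lemma star_mem_of_mem_ann {S : Set A} (hS : ∀ s ∈ S, star s ∈ S) {x : A} (hx : x ∈ Ann S) :
    star x ∈ Ann S := fun s hs => by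
  simpa [add_comm] using congrArg star (hx _ (hS s hs))

lemma star_mem_of_mem_pAnn [PartialOrder A] [StarOrderedRing A] {V : Set A} (hV : V ∈ PAnn A)
    {x : A} (hx : x ∈ V) : star x ∈ V := by
  obtain ⟨S, hS, rfl⟩ := hV
  refine star_mem_of_mem_ann (fun s hs => star_mem_of_mem_ann (fun t ht => ?_) hs) hx
  rwa [(hS t ht).isSelfAdjoint.star_eq]

end Annihilators

section CommutativeSubalgebra

variable {A : Type*} [NonUnitalCStarAlgebra A] {V : Set A}

lemma annIn_subset {X : Set A} : AnnIn V X ⊆ V := fun _ h => h.1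

lemma annIn_anti {X Y : Set A} (h : X ⊆ Y) : AnnIn V Y ⊆ AnnIn V X :=
  fun _ ha => ⟨ha.1, fun s hs => ha.2 s (h hs)⟩

lemma subset_annIn_annIn {X : Set A} (hX : X ⊆ V) : X ⊆ AnnIn V (AnnIn V X) :=
  fun a ha => ⟨hX ha, fun s hs => by rw [add_comm]; exact hs.2 a ha⟩

lemma annIn_annIn_annIn {X : Set A} (hX : X ⊆ V) :
    AnnIn V (AnnIn V (AnnIn V X)) = AnnIn V X :=
  (annIn_anti (subset_annIn_annIn hX)).antisymm (subset_annIn_annIn annIn_subset)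

lemma mem_annIn_iff (hcomm : ∀ x ∈ V, ∀ y ∈ V, x * y = y * x) {X : Set A} (hX : X ⊆ V) {a : A} :
    a ∈ AnnIn V X ↔ a ∈ V ∧ ∀ s ∈ X, a * s = 0 := by
  refine and_congr_right fun ha => forall₂_congr fun s hs => ?_
  rw [← hcomm a ha s (hX hs), add_self_eq_zero_iff]

lemma subset_of_mem_pAnnIn [PartialOrder A] {X : Set A} (hX : X ∈ PAnnIn V) : X ⊆ V := by
  obtain ⟨S, -, -, rfl⟩ := hX
  exact annIn_subset

lemma annIn_annIn_of_mem_pAnnIn [PartialOrder A] {X : Set A} (hX : X ∈ PAnnIn V) :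
    AnnIn V (AnnIn V X) = X := by
  obtain ⟨S, hS, -, rfl⟩ := hX
  exact annIn_annIn_annIn annIn_subset

lemma annIn_mul_mem (hmul : ∀ x ∈ V, ∀ y ∈ V, x * y ∈ V)
    (hcomm : ∀ x ∈ V, ∀ y ∈ V, x * y = y * x) {X : Set A} (hX : X ⊆ V) {x y : A}
    (hx : x ∈ AnnIn V X) (hy : y ∈ V) : x * y ∈ AnnIn V X := by
  rw [mem_annIn_iff hcomm hX] at hx ⊢
  refine ⟨hmul x hx.1 y hy, fun s hs => ?_⟩
  rw [hcomm x hx.1 y hy, mul_assoc, hx.2 s hs, mul_zero]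

lemma annIn_mem_pAnnIn [PartialOrder A] [StarOrderedRing A]
    (hmul : ∀ x ∈ V, ∀ y ∈ V, x * y ∈ V) (hstar : ∀ x ∈ V, star x ∈ V)
    (hcomm : ∀ x ∈ V, ∀ y ∈ V, x * y = y * x) {X : Set A} (hX : X ⊆ V) :
    AnnIn V X ∈ PAnnIn V := by
  have hT : (fun a => star a * a) '' AnnIn V X ⊆ V := by
    rintro _ ⟨a, ha, rfl⟩
    exact hmul _ (hstar a ha.1) _ ha.1
  refine ⟨(fun a => star a * a) '' AnnIn V X, hT, ?_, ?_⟩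
  · rintro _ ⟨a, -, rfl⟩
    exact star_mul_self_nonneg a
  · rw [← annIn_annIn_annIn hX]
    refine congrArg (AnnIn V) ?_
    rw [annIn_annIn_annIn hX]
    ext x
    rw [mem_annIn_iff hcomm hT, mem_annIn_iff hcomm annIn_subset]
    refine and_congr_right fun hx => ⟨?_, ?_⟩
    · rintro h _ ⟨a, ha, rfl⟩
      beta_reduce
      rw [hcomm _ (hstar a ha.1) a ha.1, ← mul_assoc, h a ha, zero_mul]
    · intro h a ha
      rw [hcomm x hx a ha.1]
      apply mul_eq_zero_of_star_mul_mul_eq_zero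
      rw [← hcomm x hx _ (hT ⟨a, ha, rfl⟩)]
      exact h _ ⟨a, ha, rfl⟩

lemma eq_zero_of_mul_self_eq_zero_of_mem (hstar : ∀ x ∈ V, star x ∈ V)
    (hcomm : ∀ x ∈ V, ∀ y ∈ V, x * y = y * x) {x : A} (hx : x ∈ V) (h : x * x = 0) : x = 0 := by
  have hn : x * star x = star x * x := hcomm x hx _ (hstar x hx)
  rw [← CStarRing.star_mul_self_eq_zero_iff, ← CStarRing.star_mul_self_eq_zero_iff]
  rw [star_mul, star_star, mul_assoc, ← mul_assoc x, hn, mul_assoc, h, mul_zero, mul_zero]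

lemma inter_annIn_subset (hmul : ∀ x ∈ V, ∀ y ∈ V, x * y ∈ V) (hstar : ∀ x ∈ V, star x ∈ V)
    (hcomm : ∀ x ∈ V, ∀ y ∈ V, x * y = y * x) {X Y Z : Set A} (hX : X ⊆ V) (hY : Y ⊆ V)
    (hZ : Z ⊆ V) (hXV : ∀ x ∈ X, ∀ y ∈ V, x * y ∈ X) (hYV : ∀ x ∈ Y, ∀ y ∈ V, x * y ∈ Y)
    (hZV : ∀ x ∈ Z, ∀ y ∈ V, x * y ∈ Z) :
    X ∩ AnnIn V (AnnIn V Y ∩ AnnIn V Z) ⊆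
      AnnIn V (AnnIn V (X ∩ Y) ∩ AnnIn V (X ∩ Z)) := by
  rintro t ⟨htX, ht⟩
  have htV := hX htX
  rw [mem_annIn_iff hcomm (Set.inter_subset_left.trans annIn_subset)] at ht ⊢
  refine ⟨htV, fun u hu => ?_⟩
  have huV : u ∈ V := hu.1.1
  have key : ∀ W ⊆ V, (∀ x ∈ W, ∀ y ∈ V, x * y ∈ W) → u ∈ AnnIn V (X ∩ W) →
      t * u ∈ AnnIn V W := fun W hW hWV hu' => by
    rw [mem_annIn_iff hcomm (Set.inter_subset_left.trans hX)] at hu'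
    rw [mem_annIn_iff hcomm hW]
    refine ⟨hmul t htV u huV, fun y hy => ?_⟩
    rw [hcomm t htV u huV, mul_assoc]
    exact hu'.2 _ ⟨hXV t htX y (hW hy), hcomm t htV y (hW hy) ▸ hWV y hy t htV⟩
  have h := ht.2 _ ⟨key Y hY hYV hu.1, key Z hZ hZV hu.2⟩
  apply eq_zero_of_mul_self_eq_zero_of_mem hstar hcomm (hmul t htV u huV)
  rw [hcomm t htV u huV, mul_assoc, ← hcomm t htV u huV, h, mul_zero]

/-- The relative annihilators of a commutative self-adjoint multiplicative set form a Boolean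
algebra under inclusion. -/
noncomputable abbrev booleanAlgebraPAnnIn [PartialOrder A] [StarOrderedRing A]
    (hmul : ∀ x ∈ V, ∀ y ∈ V, x * y ∈ V) (hstar : ∀ x ∈ V, star x ∈ V)
    (hcomm : ∀ x ∈ V, ∀ y ∈ V, x * y = y * x) : BooleanAlgebra {W : Set A // W ∈ PAnnIn V} :=
  have hmem {X : Set A} (hX : X ⊆ V) : AnnIn V X ∈ PAnnIn V :=
    annIn_mem_pAnnIn hmul hstar hcomm hX
  have hideal (X : {W : Set A // W ∈ PAnnIn V}) : ∀ x ∈ X.1, ∀ y ∈ V, x * y ∈ X.1 :=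
    fun x hx y hy => by
      rw [← annIn_annIn_of_mem_pAnnIn X.2] at hx ⊢
      exact annIn_mul_mem hmul hcomm annIn_subset hx hy
  have hsub (X : {W : Set A // W ∈ PAnnIn V}) : X.1 ⊆ V := subset_of_mem_pAnnIn X.2
  have hinter {X Y : Set A} (hX : X ∈ PAnnIn V) (hY : Y ∈ PAnnIn V) : X ∩ Y ∈ PAnnIn V := by
    have h : AnnIn V (AnnIn V X ∪ AnnIn V Y) = X ∩ Y := by
      refine (Set.subset_inter ?_ ?_).antisymm ?_
      · conv_rhs => rw [← annIn_annIn_of_mem_pAnnIn hX]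
        exact annIn_anti Set.subset_union_left
      · conv_rhs => rw [← annIn_annIn_of_mem_pAnnIn hY]
        exact annIn_anti Set.subset_union_right
      · rintro a ⟨haX, haY⟩
        refine ⟨subset_of_mem_pAnnIn hX haX, ?_⟩
        rintro s (hs | hs)
        · exact (subset_annIn_annIn (subset_of_mem_pAnnIn hX) haX).2 s hs
        · exact (subset_annIn_annIn (subset_of_mem_pAnnIn hY) haY).2 s hs
    exact h ▸ hmem (Set.union_subset annIn_subset annIn_subset)
  have hdisj (X : {W : Set A // W ∈ PAnnIn V}) : X.1 ∩ AnnIn V X.1 ⊆ AnnIn V V := by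
    rintro a ⟨haX, ha⟩
    rw [mem_annIn_iff hcomm (hsub X)] at ha
    have h0 := eq_zero_of_mul_self_eq_zero_of_mem hstar hcomm ha.1 (ha.2 a haX)
    exact ⟨ha.1, fun s _ => by rw [h0, zero_mul, mul_zero, add_zero]⟩
  let lattice : Lattice {W : Set A // W ∈ PAnnIn V} :=
    { (inferInstance : PartialOrder {W : Set A // W ∈ PAnnIn V}) with
      inf := fun X Y => ⟨X.1 ∩ Y.1, hinter X.2 Y.2⟩
      sup := fun X Y => ⟨AnnIn V (AnnIn V X.1 ∩ AnnIn V Y.1),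
        hmem (Set.inter_subset_left.trans annIn_subset)⟩
      inf_le_left := fun _ _ => Set.inter_subset_left
      inf_le_right := fun _ _ => Set.inter_subset_right
      le_inf := fun _ _ _ h₁ h₂ => Set.subset_inter h₁ h₂
      le_sup_left := fun X _ => (subset_annIn_annIn (hsub X)).trans
        (annIn_anti Set.inter_subset_left)
      le_sup_right := fun _ Y => (subset_annIn_annIn (hsub Y)).trans
        (annIn_anti Set.inter_subset_right)
      sup_le := fun _ _ Z h₁ h₂ => (annIn_anti (Set.subset_inter (annIn_anti h₁)
        (annIn_anti h₂))).trans (annIn_annIn_of_mem_pAnnIn Z.2).subset }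
  { DistribLattice.ofInfSupLe fun X Y Z => inter_annIn_subset hmul hstar hcomm (hsub X) (hsub Y)
      (hsub Z) (hideal X) (hideal Y) (hideal Z) with
    compl := fun X => ⟨AnnIn V X.1, hmem (hsub X)⟩
    top := ⟨AnnIn V ∅, hmem (Set.empty_subset V)⟩
    bot := ⟨AnnIn V V, hmem subset_rfl⟩
    le_top := fun X a ha => ⟨hsub X ha, fun s hs => hs.elim⟩
    bot_le := fun X => (annIn_anti annIn_subset).trans (annIn_annIn_of_mem_pAnnIn X.2).subset
    inf_compl_le_bot := hdisj
    top_le_sup_compl := fun X a ha => by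
      refine ⟨ha.1, fun s hs => ?_⟩
      have h := hdisj X ⟨annIn_annIn_of_mem_pAnnIn X.2 ▸ hs.2, hs.1⟩
      rw [add_comm]
      exact h.2 a ha.1 }

end CommutativeSubalgebra

section BoundsWithin

variable {α : Type*} {P : Set (Set α)} [lat : Lattice P] {x y : P} {w : Set α}

lemma IsGLBIn.eq_inf (hle : ∀ a b : P, lat.le a b ↔ (a : Set α) ⊆ b)
    (h : IsGLBIn P {x.1, y.1} w) : w = (x ⊓ y : P).1 := by
  refine Set.Subset.antisymm ?_ (h.2.2 _ (x ⊓ y).2 ?_)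
  · exact (hle ⟨w, h.1⟩ _).mp (le_inf ((hle _ _).mpr (h.2.1 _ (.inl rfl)))
      ((hle _ _).mpr (h.2.1 _ (.inr rfl))))
  · rintro _ (rfl | rfl)
    exacts [(hle _ _).mp inf_le_left, (hle _ _).mp inf_le_right]

lemma IsLUBIn.eq_sup (hle : ∀ a b : P, lat.le a b ↔ (a : Set α) ⊆ b)
    (h : IsLUBIn P {x.1, y.1} w) : w = (x ⊔ y : P).1 := by
  refine Set.Subset.antisymm (h.2.2 _ (x ⊔ y).2 ?_) ?_
  · rintro _ (rfl | rfl)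
    exacts [(hle _ _).mp le_sup_left, (hle _ _).mp le_sup_right]
  · exact (hle _ ⟨w, h.1⟩).mp (sup_le ((hle _ _).mpr (h.2.1 _ (.inl rfl)))
      ((hle _ _).mpr (h.2.1 _ (.inr rfl))))

end BoundsWithin

/-- If `V` is an Abelian annihilator of a C*-algebra `A`, then
(a) the lattice `𝒫_V` is a Boolean algebra, and (b) `𝒫_V` is modular. -/
theorem stmt_11 {A : Type*} [NonUnitalCStarAlgebra A] [PartialOrder A] [StarOrderedRing A]
    (V : Set A) (hV : V ∈ PAnn A) (hcomm : ∀ x ∈ V, ∀ y ∈ V, x * y = y * x) :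
    (∃ inst : BooleanAlgebra {W : Set A // W ∈ PAnnIn V},
      ∀ W₁ W₂ : {W : Set A // W ∈ PAnnIn V}, inst.le W₁ W₂ ↔ (W₁ : Set A) ⊆ (W₂ : Set A)) ∧
    (∀ X ∈ PAnnIn V, ∀ Y ∈ PAnnIn V, ∀ Z ∈ PAnnIn V, X ⊆ Z →
      ∀ m r₁ j r₂ : Set A, IsGLBIn (PAnnIn V) {Y, Z} m → IsLUBIn (PAnnIn V) {X, m} r₁ →
        IsLUBIn (PAnnIn V) {X, Y} j → IsGLBIn (PAnnIn V) {j, Z} r₂ → r₁ = r₂) := by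
  let inst := booleanAlgebraPAnnIn (fun _ hx _ hy => mul_mem_of_mem_pAnn hV hx hy)
    (fun _ hx => star_mem_of_mem_pAnn hV hx) hcomm
  have hle : ∀ W₁ W₂ : {W : Set A // W ∈ PAnnIn V},
      inst.le W₁ W₂ ↔ (W₁ : Set A) ⊆ (W₂ : Set A) := fun _ _ => Iff.rfl
  refine ⟨⟨inst, hle⟩, ?_⟩
  intro X hX Y hY Z hZ hXZ m r₁ j r₂ hm hr₁ hj hr₂
  let lat : Lattice (PAnnIn V) := inst.toLattice
  obtain rfl := IsGLBIn.eq_inf (x := ⟨Y, hY⟩) (y := ⟨Z, hZ⟩) hle hm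
  obtain rfl := IsLUBIn.eq_sup (x := ⟨X, hX⟩) (y := ⟨Y, hY⟩) hle hj
  rw [IsLUBIn.eq_sup (x := ⟨X, hX⟩) hle hr₁, IsGLBIn.eq_inf (y := ⟨Z, hZ⟩) hle hr₂]
  have hXZ' : inst.le ⟨X, hX⟩ ⟨Z, hZ⟩ := hXZ
  exact congrArg Subtype.val (@sup_inf_assoc_of_le _ lat inferInstance _ ⟨Y, hY⟩ _ hXZ').symm
end
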